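/- Let d ≥ 2 and q be an odd prime power with d ≡ 0 (mod 4), or d ≡ 2 (mod 4) and q ≡ 1 (mod 4). If A ⊆ F_q^d is a square distance set, then |A| ≤ q^{d/2}. -/

import Mathlib

open Finset

/-- `‖x‖ = x₁² + ⋯ + x_d²` for `x ∈ F_q^d`. -/
def normSq {d : ℕ} {F : Type} [Field F] [Fintype F] (x : Fin d → F) : F := ∑ i, x i ^ 2

/-- `A` is a square distance set: every distance `‖x−y‖` (x, y ∈ A) is zero or a
nonzero square of `F_q`. -/
def IsSquareDistanceSet {d : ℕ} {F : Type} [Field F] [Fintype F]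
    (A : Finset (Fin d → F)) : Prop :=
  ∀ x ∈ A, ∀ y ∈ A, normSq (x - y) = 0 ∨ (IsSquare (normSq (x - y)) ∧ normSq (x - y) ≠ 0)

section QuadraticExponentialSums

variable {F : Type} [Field F] [Fintype F] [DecidableEq F]

/-- The quadratic character of `F` with complex values. -/
noncomputable def complexQuadraticChar (F : Type) [Field F] [Fintype F] [DecidableEq F] :
    MulChar F ℂ :=
  (quadraticChar F).ringHomComp (Int.castRingHom ℂ)

theorem complexQuadraticChar_apply (a : F) :
    complexQuadraticChar F a = (quadraticChar F a : ℂ) := rfl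

theorem complexQuadraticChar_ne_one (hF : ringChar F ≠ 2) : complexQuadraticChar F ≠ 1 :=
  (MulChar.ringHomComp_ne_one_iff (RingHom.injective_int _)).mpr (quadraticChar_ne_one hF)

theorem complexQuadraticChar_isQuadratic : (complexQuadraticChar F).IsQuadratic :=
  (quadraticChar_isQuadratic F).comp _

theorem sum_complexQuadraticChar_mul_addChar (ψ : AddChar F ℂ) (a : F)
    (hF : ringChar F ≠ 2) :
    ∑ s, complexQuadraticChar F s * ψ (a * s) =
      complexQuadraticChar F a * gaussSum (complexQuadraticChar F) ψ := by
  rcases eq_or_ne a 0 with rfl | ha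
  · simp [MulChar.sum_eq_zero_of_ne_one (complexQuadraticChar_ne_one hF), MulChar.map_zero]
  · have h := gaussSum_mulShift_eq (complexQuadraticChar F) ψ (Units.mk0 a ha)
    rw [complexQuadraticChar_isQuadratic.inv] at h
    simpa [gaussSum] using h

theorem sum_addChar_mul_sq {ψ : AddChar F ℂ} (hψ : ψ.IsPrimitive) (hF : ringChar F ≠ 2)
    {s : F} (hs : s ≠ 0) :
    ∑ t, ψ (s * t ^ 2) = complexQuadraticChar F s * gaussSum (complexQuadraticChar F) ψ := by
  have h (u : F) : (#{t : F | t ^ 2 = u} : ℂ) = complexQuadraticChar F u + 1 := by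
    have := quadraticChar_card_sqrts hF u
    rw [complexQuadraticChar_apply]
    have h2 : (({x : F | x ^ 2 = u} : Set F).toFinset) = ({t : F | t ^ 2 = u} : Finset F) := by
      ext; simp
    rw [h2] at this
    exact_mod_cast this
  calc ∑ t, ψ (s * t ^ 2)
      = ∑ u, ∑ t with t ^ 2 = u, ψ (s * t ^ 2) :=
        (sum_fiberwise_of_maps_to (fun _ _ => mem_univ _) _).symm
    _ = ∑ u, (complexQuadraticChar F u + 1) * ψ (s * u) := by
        refine sum_congr rfl fun u _ => ?_
        rw [← h, ← nsmul_eq_mul]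
        refine sum_eq_card_nsmul fun t ht => ?_
        rw [(mem_filter.mp ht).2]
    _ = _ := by
        have h0 : ∑ u, ψ (s * u) = 0 := by
          simpa [mul_comm, hs] using AddChar.sum_mulShift s hψ
        simp only [add_mul, sum_add_distrib, one_mul, h0,
          sum_complexQuadraticChar_mul_addChar ψ s hF, add_zero]

theorem sum_addChar_mul_sq_add_mul {ψ : AddChar F ℂ} (hψ : ψ.IsPrimitive) (hF : ringChar F ≠ 2)
    {s : F} (hs : s ≠ 0) (b : F) :
    ∑ t, ψ (s * t ^ 2 + t * b) = ψ (b ^ 2 * -(4 * s)⁻¹) *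
      (complexQuadraticChar F s * gaussSum (complexQuadraticChar F) ψ) := by
  have h2 : (2 : F) ≠ 0 := Ring.two_ne_zero hF
  have h4 : (4 : F) ≠ 0 := by
    have := mul_ne_zero h2 h2
    norm_num at this
    exact this
  rw [← sum_addChar_mul_sq hψ hF hs, mul_sum, ← Equiv.sum_comp (Equiv.subRight (b / (2 * s)))]
  refine sum_congr rfl fun t _ => ?_
  rw [← AddChar.map_add_eq_mul]
  congr 1
  simp only [Equiv.subRight_apply]
  field_simp
  ring

theorem AddChar.apply_sum_eq_prod {ι G M : Type*} [AddCommMonoid G] [CommMonoid M]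
    (ψ : AddChar G M) (s : Finset ι) (f : ι → G) : ψ (∑ i ∈ s, f i) = ∏ i ∈ s, ψ (f i) :=
  map_prod ψ.toMonoidHom (fun i => Multiplicative.ofAdd (f i)) s

theorem sum_pi_addChar_normSq {d : ℕ} {ψ : AddChar F ℂ} (hψ : ψ.IsPrimitive)
    (hF : ringChar F ≠ 2) {s : F} (hs : s ≠ 0) (x : Fin d → F) :
    ∑ ξ : Fin d → F, ψ (s * normSq ξ + ξ ⬝ᵥ x) = ψ (normSq x * -(4 * s)⁻¹) *
      (complexQuadraticChar F s * gaussSum (complexQuadraticChar F) ψ) ^ d := by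
  have hsplit (ξ : Fin d → F) :
      ψ (s * normSq ξ + ξ ⬝ᵥ x) = ∏ i, ψ (s * ξ i ^ 2 + ξ i * x i) := by
    rw [← AddChar.apply_sum_eq_prod, sum_add_distrib, ← mul_sum]
    rfl
  simp only [hsplit]
  rw [← Fintype.prod_sum (fun i t => ψ (s * t ^ 2 + t * x i))]
  simp only [sum_addChar_mul_sq_add_mul hψ hF hs, prod_mul_distrib, prod_const, card_univ,
    Fintype.card_fin, ← AddChar.apply_sum_eq_prod, ← sum_mul, normSq, mul_pow]

theorem sum_pi_addChar_dotProduct {d : ℕ} {ψ : AddChar F ℂ} (hψ : ψ.IsPrimitive)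
    (x : Fin d → F) :
    ∑ ξ : Fin d → F, ψ (ξ ⬝ᵥ x) = if x = 0 then (Fintype.card F : ℂ) ^ d else 0 := by
  have hsplit (ξ : Fin d → F) : ψ (ξ ⬝ᵥ x) = ∏ i, ψ (ξ i * x i) := by
    rw [← AddChar.apply_sum_eq_prod]
    rfl
  simp only [hsplit]
  rw [← Fintype.prod_sum (fun i t => ψ (t * x i))]
  simp only [AddChar.sum_mulShift _ hψ]
  split_ifs with hx
  · simp [hx]
  · obtain ⟨i, hi⟩ := Function.ne_iff.mp hx
    exact prod_eq_zero (mem_univ i) (by simpa using hi)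

/-- The common value `q ^ (d / 2)` of the `d`-th powers of the quadratic Gauss sums, when the
standard quadratic form in dimension `d` is hyperbolic. -/
theorem complexQuadraticChar_mul_gaussSum_pow {d : ℕ} {ψ : AddChar F ℂ} (hψ : ψ.IsPrimitive)
    (hF : ringChar F ≠ 2)
    (hd : d % 4 = 0 ∨ (d % 4 = 2 ∧ Fintype.card F % 4 = 1)) {s : F} (hs : s ≠ 0) :
    (complexQuadraticChar F s * gaussSum (complexQuadraticChar F) ψ) ^ d =
      (Fintype.card F : ℂ) ^ (d / 2) := by
  have hsq : complexQuadraticChar F s ^ 2 = 1 := by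
    rw [complexQuadraticChar_apply]
    exact_mod_cast quadraticChar_sq_one hs
  have hneg : complexQuadraticChar F (-1) ^ (d / 2) = 1 := by
    rcases hd with hd | ⟨-, hq⟩
    · obtain ⟨k, hk⟩ : ∃ k, d / 2 = 2 * k := ⟨d / 4, by omega⟩
      have : complexQuadraticChar F (-1) ^ 2 = 1 := by
        rw [← map_pow, neg_one_sq, map_one]
      rw [hk, pow_mul, this, one_pow]
    · have : quadraticChar F (-1) = 1 := by
        rw [quadraticChar_neg_one hF, ZMod.χ₄_nat_one_mod_four hq]
      rw [complexQuadraticChar_apply, this, Int.cast_one, one_pow]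
  have hd2 : d = 2 * (d / 2) := by omega
  conv_lhs => rw [hd2]
  rw [pow_mul, mul_pow, hsq, one_mul,
    gaussSum_sq (complexQuadraticChar_ne_one hF) complexQuadraticChar_isQuadratic hψ,
    mul_pow, hneg, one_mul]

/-- The Fourier transform of a function of `normSq`, itself given by its Fourier expansion. -/
theorem sum_fourier_normSq {d : ℕ} {ψ : AddChar F ℂ} (hψ : ψ.IsPrimitive)
    (hF : ringChar F ≠ 2)
    (hd : d % 4 = 0 ∨ (d % 4 = 2 ∧ Fintype.card F % 4 = 1)) (w : F → ℂ) (x : Fin d → F) :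
    ∑ ξ : Fin d → F, (∑ s, w s * ψ (normSq ξ * s)) * ψ (ξ ⬝ᵥ x) =
      (Fintype.card F : ℂ) ^ (d / 2) * ∑ s, w (-(4 * s)⁻¹) * ψ (normSq x * s) +
      w 0 * ((if x = 0 then (Fintype.card F : ℂ) ^ d else 0) -
        (Fintype.card F : ℂ) ^ (d / 2)) := by
  have h2 : (2 : F) ≠ 0 := Ring.two_ne_zero hF
  have h4 : (4 : F) ≠ 0 := by
    have := mul_ne_zero h2 h2
    norm_num at this
    exact this
  have hinv : Function.Involutive fun s : F => -(4 * s)⁻¹ := by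
    intro s
    rcases eq_or_ne s 0 with rfl | hs
    · simp
    · field_simp
  have hcomm : ∑ ξ : Fin d → F, (∑ s, w s * ψ (normSq ξ * s)) * ψ (ξ ⬝ᵥ x) =
      ∑ s, w s * ∑ ξ : Fin d → F, ψ (s * normSq ξ + ξ ⬝ᵥ x) := by
    simp only [sum_mul, mul_sum]
    rw [sum_comm]
    refine sum_congr rfl fun s _ => sum_congr rfl fun ξ _ => ?_
    rw [AddChar.map_add_eq_mul, mul_comm s, mul_assoc]
  have hterm (s : F) : w s * ∑ ξ : Fin d → F, ψ (s * normSq ξ + ξ ⬝ᵥ x) =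
      (Fintype.card F : ℂ) ^ (d / 2) * (w s * ψ (normSq x * -(4 * s)⁻¹)) +
      if s = 0 then w 0 * ((if x = 0 then (Fintype.card F : ℂ) ^ d else 0) -
        (Fintype.card F : ℂ) ^ (d / 2)) else 0 := by
    rcases eq_or_ne s 0 with rfl | hs
    · simp only [zero_mul, zero_add, sum_pi_addChar_dotProduct hψ, mul_zero, inv_zero, neg_zero,
        AddChar.map_zero_eq_one, if_true]
      ring
    · rw [sum_pi_addChar_normSq hψ hF hs, complexQuadraticChar_mul_gaussSum_pow hψ hF hd hs,
        if_neg hs]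
      ring
  rw [hcomm, sum_congr rfl fun s _ => hterm s, sum_add_distrib, ← mul_sum, sum_ite_eq',
    if_pos (mem_univ _), ← Equiv.sum_comp (Function.Involutive.toPerm _ hinv)]
  congr 3 with s
  simp only [Function.Involutive.coe_toPerm]
  exact congrArg (fun t => w (-(4 * s)⁻¹) * ψ (normSq x * t)) (hinv s)

theorem fourier_normSq_eq_zero {d : ℕ} {ψ : AddChar F ℂ} (hψ : ψ.IsPrimitive)
    (hF : ringChar F ≠ 2)
    (hd : d % 4 = 0 ∨ (d % 4 = 2 ∧ Fintype.card F % 4 = 1)) (x : Fin d → F) :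
    (Fintype.card F : ℂ) * ∑ ξ : Fin d → F, (if normSq ξ = 0 then 1 else 0) * ψ (ξ ⬝ᵥ x) =
      (Fintype.card F : ℂ) ^ (d / 2) * (Fintype.card F * (if normSq x = 0 then 1 else 0) - 1) +
        if x = 0 then (Fintype.card F : ℂ) ^ d else 0 := by
  have hδ (c : F) : ∑ s, ψ (c * s) = (Fintype.card F : ℂ) * if c = 0 then 1 else 0 := by
    simpa [mul_comm] using AddChar.sum_mulShift c hψ
  have h := sum_fourier_normSq hψ hF hd (fun _ => 1) x
  simp only [one_mul, hδ] at h
  rw [mul_sum]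
  simp only [← mul_assoc]
  rw [h]
  ring

theorem fourier_quadraticChar_normSq {d : ℕ} {ψ : AddChar F ℂ} (hψ : ψ.IsPrimitive)
    (hF : ringChar F ≠ 2)
    (hd : d % 4 = 0 ∨ (d % 4 = 2 ∧ Fintype.card F % 4 = 1)) (x : Fin d → F) :
    ∑ ξ : Fin d → F, complexQuadraticChar F (-normSq ξ) * ψ (ξ ⬝ᵥ x) =
      (Fintype.card F : ℂ) ^ (d / 2) * complexQuadraticChar F (normSq x) := by
  have hG : gaussSum (complexQuadraticChar F) ψ ≠ 0 :=
    gaussSum_ne_zero_of_nontrivial (by exact_mod_cast Fintype.card_ne_zero)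
      (complexQuadraticChar_ne_one hF) hψ
  have hneg (c : F) : complexQuadraticChar F (-c) =
      complexQuadraticChar F (-1) * complexQuadraticChar F c := by
    rw [← map_mul, neg_one_mul]
  have hsq : complexQuadraticChar F (-1) * complexQuadraticChar F (-1) = 1 := by
    rw [← map_mul, neg_one_mul, neg_neg, map_one]
  have hw (s : F) : complexQuadraticChar F (-(4 * s)⁻¹) =
      complexQuadraticChar F (-1) * complexQuadraticChar F s := by
    have h2 : (2 : F) ≠ 0 := Ring.two_ne_zero hF
    rcases eq_or_ne s 0 with rfl | hs
    · simp [MulChar.map_zero]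
    · have : -(4 * s)⁻¹ = -1 * s * ((2 * s)⁻¹ ^ 2) := by
        have h4 : (4 : F) = 2 * 2 := by norm_num
        rw [h4]
        field_simp
      rw [this, map_mul, map_mul, complexQuadraticChar_apply ((2 * s)⁻¹ ^ 2),
        quadraticChar_sq_one' (inv_ne_zero (mul_ne_zero h2 hs)), Int.cast_one, mul_one]
  have h := sum_fourier_normSq hψ hF hd (complexQuadraticChar F) x
  simp only [hw, sum_complexQuadraticChar_mul_addChar ψ _ hF, MulChar.map_zero, zero_mul,
    add_zero, mul_assoc, ← mul_sum] at h
  apply mul_left_cancel₀ hG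
  calc gaussSum (complexQuadraticChar F) ψ *
        ∑ ξ : Fin d → F, complexQuadraticChar F (-normSq ξ) * ψ (ξ ⬝ᵥ x)
      = complexQuadraticChar F (-1) * ∑ ξ : Fin d → F, complexQuadraticChar F (normSq ξ) *
          (gaussSum (complexQuadraticChar F) ψ * ψ (ξ ⬝ᵥ x)) := by
        rw [mul_sum, mul_sum]
        refine sum_congr rfl fun ξ _ => ?_
        rw [hneg]
        ring
    _ = _ := by
        rw [h]
        linear_combination (Fintype.card F : ℂ) ^ (d / 2) * complexQuadraticChar F (normSq x) *
          gaussSum (complexQuadraticChar F) ψ * hsq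

/-- Twice the indicator function of the `c` such that `-c` is not a square. -/
def negNonsquareWeight (c : F) : ℤ := 1 - quadraticChar F (-c) - if c = 0 then 1 else 0

theorem negNonsquareWeight_nonneg (c : F) : 0 ≤ negNonsquareWeight c := by
  unfold negNonsquareWeight
  split_ifs with hc
  · simp [hc]
  · rcases quadraticChar_dichotomy (neg_ne_zero.mpr hc) with h | h <;> rw [h] <;> norm_num

theorem fourier_negNonsquareWeight {d : ℕ} {ψ : AddChar F ℂ} (hψ : ψ.IsPrimitive)
    (hF : ringChar F ≠ 2)
    (hd : d % 4 = 0 ∨ (d % 4 = 2 ∧ Fintype.card F % 4 = 1)) {x : Fin d → F}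
    (hx : IsSquare (normSq x)) :
    (Fintype.card F : ℂ) * ∑ ξ : Fin d → F, (negNonsquareWeight (normSq ξ) : ℂ) * ψ (ξ ⬝ᵥ x) =
      (Fintype.card F - 1) * (Fintype.card F : ℂ) ^ (d / 2) *
        ((if x = 0 then (Fintype.card F : ℂ) ^ (d / 2) else 0) - 1) := by
  have hsum : ∑ ξ : Fin d → F, (negNonsquareWeight (normSq ξ) : ℂ) * ψ (ξ ⬝ᵥ x) =
      ∑ ξ : Fin d → F, ψ (ξ ⬝ᵥ x) -
      ∑ ξ : Fin d → F, complexQuadraticChar F (-normSq ξ) * ψ (ξ ⬝ᵥ x) -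
      ∑ ξ : Fin d → F, (if normSq ξ = 0 then 1 else 0) * ψ (ξ ⬝ᵥ x) := by
    rw [← sum_sub_distrib, ← sum_sub_distrib]
    refine sum_congr rfl fun ξ _ => ?_
    rw [negNonsquareWeight, complexQuadraticChar_apply]
    push_cast
    ring
  have hval : complexQuadraticChar F (normSq x) = 1 - if normSq x = 0 then 1 else 0 := by
    rw [complexQuadraticChar_apply]
    split_ifs with h
    · simp [h]
    · rw [(quadraticChar_one_iff_isSquare h).mpr hx]
      simp
  have hpow : (Fintype.card F : ℂ) ^ d =
      (Fintype.card F : ℂ) ^ (d / 2) * (Fintype.card F : ℂ) ^ (d / 2) := by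
    rw [← pow_add]
    congr 1
    omega
  rw [hsum, mul_sub, mul_sub, fourier_normSq_eq_zero hψ hF hd,
    fourier_quadraticChar_normSq hψ hF hd, sum_pi_addChar_dotProduct hψ, hval, hpow]
  split_ifs <;> ring

end QuadraticExponentialSums

theorem exists_sum_sum_fourier_eq_nonneg {d : ℕ} {F : Type} [Field F] [Fintype F]
    (ψ : AddChar F ℂ) (w : (Fin d → F) → ℤ)
    (hw : ∀ ξ, 0 ≤ w ξ) (A : Finset (Fin d → F)) :
    ∃ r : ℝ, 0 ≤ r ∧
      ∑ x ∈ A, ∑ y ∈ A, ∑ ξ : Fin d → F, (w ξ : ℂ) * ψ (ξ ⬝ᵥ (x - y)) = r := by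
  refine ⟨∑ ξ : Fin d → F, (w ξ : ℝ) * Complex.normSq (∑ x ∈ A, ψ (ξ ⬝ᵥ x)),
    sum_nonneg fun ξ _ => mul_nonneg (by exact_mod_cast hw ξ) (Complex.normSq_nonneg _), ?_⟩
  push_cast
  simp only [← Complex.mul_conj, map_sum, sum_mul_sum]
  simp only [mul_sum]
  rw [sum_comm (s := univ)]
  refine sum_congr rfl fun x _ => ?_
  rw [sum_comm (s := univ)]
  refine sum_congr rfl fun y _ => sum_congr rfl fun ξ _ => ?_
  rw [dotProduct_sub, sub_eq_add_neg, AddChar.map_add_eq_mul, AddChar.map_neg_eq_conj]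

theorem squareDistanceSet_card_even_plus (q d : ℕ) (F : Type) [Field F] [Fintype F] [DecidableEq F]
    (hcard : Fintype.card F = q) (hodd : Odd q)
    (hd : d % 4 = 0 ∨ (d % 4 = 2 ∧ q % 4 = 1)) (hd2 : 2 ≤ d)
    (A : Finset (Fin d → F)) (hA : IsSquareDistanceSet A) :
    (A.card : ℝ) ≤ (q : ℝ) ^ (d / 2) := by
  subst hcard
  have hF : ringChar F ≠ 2 := fun h => by
    have := FiniteField.even_card_of_char_two h
    have := Nat.odd_iff.mp hodd
    omega
  have hsquare {x y : Fin d → F} (hx : x ∈ A) (hy : y ∈ A) : IsSquare (normSq (x - y)) := by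
    rcases hA x hx y hy with h | h
    · rw [h]
      exact IsSquare.zero
    · exact h.1
  obtain ⟨ψ, hψ1⟩ := (AddChar.exists_apply_ne_zero (a := (1 : F))).mpr one_ne_zero
  have hψ : ψ.IsPrimitive := AddChar.IsPrimitive.of_ne_one fun h => hψ1 (by simp [h])
  obtain ⟨r, hr, hsum⟩ := exists_sum_sum_fourier_eq_nonneg ψ
    (fun ξ => negNonsquareWeight (normSq ξ)) (fun ξ => negNonsquareWeight_nonneg _) A
  have hcount : (Fintype.card F : ℂ) * r = (Fintype.card F - 1) * (Fintype.card F : ℂ) ^ (d / 2) *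
      (A.card * (Fintype.card F : ℂ) ^ (d / 2) - A.card * A.card) := by
    rw [← hsum, mul_sum]
    simp only [mul_sum (s := A)]
    rw [sum_congr rfl fun x hx => sum_congr rfl fun y hy =>
      fourier_negNonsquareWeight hψ hF hd (hsquare hx hy)]
    simp only [← mul_sum, sum_sub_distrib, sub_eq_zero, sum_ite_eq, sum_const, nsmul_eq_mul,
      mul_one]
    congr 2
    rw [sum_congr rfl fun x hx => if_pos hx, sum_const, nsmul_eq_mul]
  have hreal : (Fintype.card F : ℝ) * r = (Fintype.card F - 1) * (Fintype.card F : ℝ) ^ (d / 2) *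
      (A.card * (Fintype.card F : ℝ) ^ (d / 2) - A.card * A.card) := by
    exact_mod_cast hcount
  have hq : (1 : ℝ) < Fintype.card F := by exact_mod_cast Fintype.one_lt_card
  have hpos : 0 < ((Fintype.card F : ℝ) - 1) * (Fintype.card F : ℝ) ^ (d / 2) :=
    mul_pos (sub_pos.mpr hq) (by positivity)
  have hle : 0 ≤ (A.card : ℝ) * (Fintype.card F : ℝ) ^ (d / 2) - A.card * A.card :=
    nonneg_of_mul_nonneg_right (hreal ▸ by positivity) hpos
  rcases (Nat.cast_nonneg (α := ℝ) A.card).eq_or_lt with h0 | h0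
  · rw [← h0]
    positivity
  · exact le_of_mul_le_mul_left (sub_nonneg.mp hle) h0
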